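/- arXiv:1504.04762 — 3 statements merged into one kernel-verified Lean document; each statement's English description precedes it below -/
import Mathlib

section
/- In the first Heisenberg group there exists a constant C > 0, independent of ε > 0, such that for any two points differing only in the third coordinate, x = (x₁, x₂, s) and x' = (x₁, x₂, t), one has d_ε(x, x') ≤ C min(ε⁻¹|t − s|, √|t − s|). -/
/-!
STATEMENT 7: In the first Heisenberg group, for points differing only in the third
coordinate, `d_ε(x,x') ≤ C min(ε⁻¹|t−s|, √|t−s|)` with `C` independent of `ε`.
-/

open MeasureTheory Set

noncomputable section

/-- The left-invariant horizontal field `X₁ = ∂_{x₁} − x₂ ∂_{x₃}` of `ℍ¹`. -/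
def hX1 : (Fin 3 → ℝ) → (Fin 3 → ℝ) := fun x => ![1, 0, -x 1]

/-- The left-invariant horizontal field `X₂ = ∂_{x₂} + x₁ ∂_{x₃}` of `ℍ¹`. -/
def hX2 : (Fin 3 → ℝ) → (Fin 3 → ℝ) := fun x => ![0, 1, x 0]

/-- The vertical field `X₃ = ∂_{x₃}`. -/
def hX3 : (Fin 3 → ℝ) → (Fin 3 → ℝ) := fun _ => ![0, 0, 1]

/-- The Heisenberg group product. -/
def hMul (x y : Fin 3 → ℝ) : Fin 3 → ℝ :=
  ![x 0 + y 0, x 1 + y 1, x 2 + y 2 - (x 1 * y 0 - x 0 * y 1)]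

/-- The Heisenberg group inverse. -/
def hInv (y : Fin 3 → ℝ) : Fin 3 → ℝ := ![-y 0, -y 1, -y 2]

/-- The Korányi gauge `|x| = ((x₁²+x₂²)² + x₃²)^{1/4}`. -/
def hGauge (x : Fin 3 → ℝ) : ℝ := ((x 0 ^ 2 + x 1 ^ 2) ^ 2 + x 2 ^ 2) ^ ((1 : ℝ) / 4)

/-- The Carnot–Carathéodory distance of the horizontal frame `(X₁, X₂)`: the infimum
over horizontal absolutely continuous curves joining `x` to `y` of the essential
supremum of `√(a₁² + a₂²)`. -/
def dH0 (x y : Fin 3 → ℝ) : ℝ :=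
  sInf {δ : ℝ | ∃ γ : ℝ → Fin 3 → ℝ, ∃ a₁ a₂ : ℝ → ℝ,
    γ 0 = x ∧ γ 1 = y ∧ (∃ L, LipschitzOnWith L γ (Set.Icc 0 1)) ∧
    ∀ᵐ t ∂(volume.restrict (Set.Icc (0 : ℝ) 1)),
      HasDerivAt γ (a₁ t • hX1 (γ t) + a₂ t • hX2 (γ t)) t ∧
      Real.sqrt (a₁ t ^ 2 + a₂ t ^ 2) ≤ δ}

/-- The Riemannian distance `d_ε` for which `X₁, X₂, εX₃` is an orthonormal frame:
the infimum of `∫₀¹ √(a₁² + a₂² + ε⁻²a₃²) dt` over a.e. tangent curves from `x` to `y`. -/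
def dHeps (ε : ℝ) (x y : Fin 3 → ℝ) : ℝ :=
  sInf {ℓ : ℝ | ∃ γ : ℝ → Fin 3 → ℝ, ∃ a : Fin 3 → ℝ → ℝ,
    γ 0 = x ∧ γ 1 = y ∧ (∃ L, LipschitzOnWith L γ (Set.Icc 0 1)) ∧
    (∀ᵐ t ∂(volume.restrict (Set.Icc (0 : ℝ) 1)),
      HasDerivAt γ (a 0 t • hX1 (γ t) + a 1 t • hX2 (γ t) + a 2 t • hX3 (γ t)) t) ∧
    ℓ = ∫ t in (0:ℝ)..1, Real.sqrt (a 0 t ^ 2 + a 1 t ^ 2 + ε⁻¹ ^ 2 * a 2 t ^ 2)}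

/-- A `C¹` curve tangent to the frame with constant `ε`-speed `v` bounds `d_ε` by `v`. -/
theorem dHeps_le_of_constant_speed {ε v : ℝ} {γ : ℝ → Fin 3 → ℝ} {a : Fin 3 → ℝ → ℝ}
    (hγ : ContDiff ℝ 1 γ)
    (hderiv : ∀ u, HasDerivAt γ
      (a 0 u • hX1 (γ u) + a 1 u • hX2 (γ u) + a 2 u • hX3 (γ u)) u)
    (hspeed : ∀ u, Real.sqrt (a 0 u ^ 2 + a 1 u ^ 2 + ε⁻¹ ^ 2 * a 2 u ^ 2) = v) :
    dHeps ε (γ 0) (γ 1) ≤ v := by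
  refine csInf_le ⟨0, ?_⟩ ⟨γ, a, rfl, rfl, ?_, .of_forall hderiv, ?_⟩
  · rintro ℓ ⟨_, _, -, -, -, -, rfl⟩
    exact intervalIntegral.integral_nonneg zero_le_one fun _ _ => Real.sqrt_nonneg _
  · exact hγ.contDiffOn.exists_lipschitzOnWith one_ne_zero (convex_Icc 0 1) isCompact_Icc
  · simp only [hspeed, intervalIntegral.integral_const, sub_zero, one_smul]

/-- The vertical segment bounds `d_ε` between points of a common vertical line. -/
theorem dHeps_vertical_le_segment {ε : ℝ} (hε : 0 < ε) (x₁ x₂ s t : ℝ) :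
    dHeps ε ![x₁, x₂, s] ![x₁, x₂, t] ≤ ε⁻¹ * |t - s| := by
  have h := dHeps_le_of_constant_speed (ε := ε) (v := ε⁻¹ * |t - s|)
    (γ := fun u => ![x₁, x₂, s + u * (t - s)]) (a := fun i _ => ![0, 0, t - s] i) ?_ ?_ ?_
  · simpa using h
  · refine contDiff_pi.2 fun i => ?_
    fin_cases i <;> simp <;> fun_prop
  · intro u
    refine hasDerivAt_pi.2 fun i => ?_
    fin_cases i
    · simpa [hX1, hX2, hX3] using hasDerivAt_const u x₁
    · simpa [hX1, hX2, hX3] using hasDerivAt_const u x₂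
    · simpa [hX1, hX2, hX3] using ((hasDerivAt_id u).mul_const (t - s)).const_add s
  · intro u
    have : Real.sqrt ((ε⁻¹ * (t - s)) ^ 2) = ε⁻¹ * |t - s| := by
      rw [Real.sqrt_sq_eq_abs, abs_mul, abs_of_pos (inv_pos.2 hε)]
    simpa [mul_pow] using this

/-- The horizontal lift of a circle of radius `r`, traversed once with angular velocity `ω`,
rises by `r² ω`. -/
theorem dHeps_vertical_le_circle {ε r ω : ℝ} (hω : |ω| = 2 * Real.pi) (hr : 0 ≤ r)
    (x₁ x₂ s : ℝ) :
    dHeps ε ![x₁, x₂, s] ![x₁, x₂, s + r ^ 2 * ω] ≤ r * (2 * Real.pi) := by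
  have hcos : Real.cos ω = 1 := by rw [← Real.cos_abs, hω, Real.cos_two_pi]
  have hsin : Real.sin ω = 0 := by
    have := Real.sin_sq_add_cos_sq ω
    rw [hcos] at this
    exact pow_eq_zero_iff two_ne_zero |>.1 (by linarith)
  have h := dHeps_le_of_constant_speed (ε := ε) (v := r * (2 * Real.pi))
    (γ := fun u => ![x₁ + r * (Real.cos (u * ω) - 1), x₂ + r * Real.sin (u * ω),
      s + r * (x₂ * (1 - Real.cos (u * ω)) + (x₁ - r) * Real.sin (u * ω) + r * (u * ω))])
    (a := fun i u => ![-(r * ω * Real.sin (u * ω)), r * ω * Real.cos (u * ω), 0] i) ?_ ?_ ?_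
  · convert h using 2
    · simp
    · simp only [one_mul, hcos, hsin]
      ring_nf
  · refine contDiff_pi.2 fun i => ?_
    fin_cases i <;> simp <;> fun_prop
  · intro u
    have hθ : HasDerivAt (fun u : ℝ => u * ω) ω u := by
      simpa using (hasDerivAt_id u).mul_const ω
    refine hasDerivAt_pi.2 fun i => ?_
    fin_cases i
    · refine (((hθ.cos.sub_const 1).const_mul r).const_add x₁).congr_deriv ?_
      simp [hX1, hX2, hX3]
      ring
    · refine ((hθ.sin.const_mul r).const_add x₂).congr_deriv ?_
      simp [hX1, hX2, hX3]
      ring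
    · refine ((((((hθ.cos.const_sub 1).const_mul x₂).add
        (hθ.sin.const_mul (x₁ - r))).add (hθ.const_mul r)).const_mul r).const_add s).congr_deriv ?_
      simp [hX1, hX2, hX3]
      linear_combination -(r ^ 2 * ω) * Real.sin_sq_add_cos_sq (u * ω)
  · intro u
    have hsq : (-(r * ω * Real.sin (u * ω))) ^ 2 + (r * ω * Real.cos (u * ω)) ^ 2
        = (r * ω) ^ 2 := by
      linear_combination (r * ω) ^ 2 * Real.sin_sq_add_cos_sq (u * ω)
    have : Real.sqrt ((r * ω) ^ 2) = r * (2 * Real.pi) := by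
      rw [Real.sqrt_sq_eq_abs, abs_mul, hω, abs_of_nonneg hr]
    simpa [← hsq] using this

/-- Horizontal circles bound `d_ε` between points of a common vertical line, uniformly in `ε`. -/
theorem dHeps_vertical_le_sqrt (ε x₁ x₂ s t : ℝ) :
    dHeps ε ![x₁, x₂, s] ![x₁, x₂, t] ≤ 3 * Real.sqrt |t - s| := by
  have hpi : 0 < 2 * Real.pi := Real.two_pi_pos
  obtain ⟨ω, hω, hts⟩ : ∃ ω : ℝ, |ω| = 2 * Real.pi ∧
      Real.sqrt (|t - s| / (2 * Real.pi)) ^ 2 * ω = t - s := by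
    rw [Real.sq_sqrt (by positivity)]
    rcases abs_choice (t - s) with h | h
    · exact ⟨2 * Real.pi, abs_of_pos hpi, by rw [h]; field_simp⟩
    · exact ⟨-(2 * Real.pi), by rw [abs_neg, abs_of_pos hpi], by rw [h]; field_simp⟩
  have h := dHeps_vertical_le_circle (ε := ε) hω
    (Real.sqrt_nonneg (|t - s| / (2 * Real.pi))) x₁ x₂ s
  rw [hts, add_sub_cancel] at h
  refine h.trans (abs_le_of_sq_le_sq' ?_ (by positivity)).2
  rw [mul_pow _ (2 * Real.pi), mul_pow 3, Real.sq_sqrt (by positivity),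
    Real.sq_sqrt (abs_nonneg _)]
  have : |t - s| / (2 * Real.pi) * (2 * Real.pi) ^ 2 = |t - s| * (2 * Real.pi) := by
    field_simp
  rw [this]
  nlinarith [Real.pi_le_four, abs_nonneg (t - s)]

/-- **Vertical distance estimate, uniform in `ε`**. -/
theorem heisenberg_vertical_estimate :
    ∃ C : ℝ, 0 < C ∧ ∀ ε : ℝ, 0 < ε → ∀ x₁ x₂ s t : ℝ,
      dHeps ε ![x₁, x₂, s] ![x₁, x₂, t] ≤
        C * min (ε⁻¹ * |t - s|) (Real.sqrt |t - s|) := by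
  refine ⟨3, by norm_num, fun ε hε x₁ x₂ s t => ?_⟩
  rw [mul_min_of_nonneg _ _ (by norm_num)]
  refine le_min ((dHeps_vertical_le_segment hε x₁ x₂ s t).trans ?_)
    (dHeps_vertical_le_sqrt ε x₁ x₂ s t)
  have : 0 ≤ ε⁻¹ * |t - s| := by positivity
  linarith

end
end

section
/- In the first Heisenberg group there exists a constant A > 0, independent of ε > 0, such that for all x, y ∈ ℝ³: A⁻¹ d_{G,ε}(x,y) ≤ d_ε(x,y) ≤ A d_{G,ε}(x,y), where d_{G,ε}(x,y) = N_ε(y⁻¹x) is the regularized gauge pseudo-distance. -/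
/-!
STATEMENT 8: In the first Heisenberg group the Riemannian approximating distances
`d_ε` are comparable, uniformly in `ε > 0`, to the regularized gauge pseudo-distances
`d_{G,ε}(x,y) = N_ε(y⁻¹x)`.
-/

open MeasureTheory Set

noncomputable section

/-- The regularized gauge `N_ε(x) = (x₁² + x₂² + min(|x₃|, ε⁻²x₃²))^{1/2}`. -/
def hNeps (ε : ℝ) (x : Fin 3 → ℝ) : ℝ :=
  Real.sqrt (x 0 ^ 2 + x 1 ^ 2 + min |x 2| (ε⁻¹ ^ 2 * x 2 ^ 2))

/-- The gauge pseudo-distance `d_{G,ε}(x,y) = N_ε(y⁻¹ x)`. -/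
def hdGeps (ε : ℝ) (x y : Fin 3 → ℝ) : ℝ := hNeps ε (hMul (hInv y) x)

/-- A Lipschitz curve in `ℝⁿ` has absolutely continuous coordinates. -/
lemma LipschitzOnWith.absolutelyContinuousOnInterval_apply {ι : Type*} [Fintype ι]
    {γ : ℝ → ι → ℝ} {L : NNReal} {a b : ℝ} (h : LipschitzOnWith L γ (uIcc a b)) (i : ι) :
    AbsolutelyContinuousOnInterval (fun t => γ t i) a b := by
  have h1 : LipschitzOnWith L (fun t => γ t i) (uIcc a b) := fun x hx y hy =>
    (edist_le_pi_edist (γ x) (γ y) i).trans (h hx hy)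
  exact h1.absolutelyContinuousOnInterval

lemma AbsolutelyContinuousOnInterval.abs_sub_le_integral {f s : ℝ → ℝ} {a b : ℝ} (hab : a ≤ b)
    (hf : AbsolutelyContinuousOnInterval f a b) (hs : IntervalIntegrable s volume a b)
    (hfs : ∀ᵐ t ∂(volume.restrict (Icc a b)), |deriv f t| ≤ s t) :
    |f b - f a| ≤ ∫ t in a..b, s t := by
  rw [← hf.integral_deriv_eq_sub]
  exact (intervalIntegral.abs_integral_le_integral_abs hab).trans
    (intervalIntegral.integral_mono_ae_restrict hab hf.intervalIntegrable_deriv.abs hs hfs)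

/-- The speed of `a₁X₁ + a₂X₂ + a₃X₃` in the metric for which `X₁, X₂, εX₃` is orthonormal. -/
def hSpeed (ε : ℝ) (a : Fin 3 → ℝ → ℝ) (t : ℝ) : ℝ :=
  Real.sqrt (a 0 t ^ 2 + a 1 t ^ 2 + ε⁻¹ ^ 2 * a 2 t ^ 2)

lemma hSpeed_nonneg (ε : ℝ) (a : Fin 3 → ℝ → ℝ) (t : ℝ) : 0 ≤ hSpeed ε a t := Real.sqrt_nonneg _

lemma abs_zero_le_hSpeed (ε : ℝ) (a : Fin 3 → ℝ → ℝ) (t : ℝ) : |a 0 t| ≤ hSpeed ε a t :=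
  Real.abs_le_sqrt (by nlinarith [sq_nonneg (a 1 t), sq_nonneg (ε⁻¹ * a 2 t)])

lemma abs_one_le_hSpeed (ε : ℝ) (a : Fin 3 → ℝ → ℝ) (t : ℝ) : |a 1 t| ≤ hSpeed ε a t :=
  Real.abs_le_sqrt (by nlinarith [sq_nonneg (a 0 t), sq_nonneg (ε⁻¹ * a 2 t)])

lemma abs_two_le_hSpeed {ε : ℝ} (hε : 0 < ε) (a : Fin 3 → ℝ → ℝ) (t : ℝ) :
    |a 2 t| ≤ ε * hSpeed ε a t := by
  have h : |ε⁻¹ * a 2 t| ≤ hSpeed ε a t :=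
    Real.abs_le_sqrt (by nlinarith [sq_nonneg (a 0 t), sq_nonneg (a 1 t)])
  rw [abs_mul, abs_of_pos (inv_pos.2 hε), inv_mul_le_iff₀ hε] at h
  exact h

/-- The coordinate form of the equation `γ′ = a₁X₁(γ) + a₂X₂(γ) + a₃X₃(γ)`. -/
lemma hasDerivAt_frame_iff {γ : ℝ → Fin 3 → ℝ} {p q r t : ℝ} :
    HasDerivAt γ (p • hX1 (γ t) + q • hX2 (γ t) + r • hX3 (γ t)) t ↔
      HasDerivAt (fun τ => γ τ 0) p t ∧ HasDerivAt (fun τ => γ τ 1) q t ∧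
        HasDerivAt (fun τ => γ τ 2) (r - γ t 1 * p + γ t 0 * q) t := by
  rw [hasDerivAt_pi, Fin.forall_fin_succ, Fin.forall_fin_two]
  have h : -(p * γ t 1) + q * γ t 0 + r = r - γ t 1 * p + γ t 0 * q := by ring
  simp [hX1, hX2, hX3, h]

/-- The gauge is controlled by a length bound on the left-translated endpoint. -/
lemma hNeps_le {ε l : ℝ} (hε : 0 < ε) (hl : 0 ≤ l) {z : Fin 3 → ℝ} (h0 : |z 0| ≤ l)
    (h1 : |z 1| ≤ l) (h2 : |z 2| ≤ (ε + 2 * l) * l) : hNeps ε z ≤ 4 * l := by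
  rw [hNeps, Real.sqrt_le_left (by positivity)]
  have h0' : z 0 ^ 2 ≤ l ^ 2 := sq_le_sq' (abs_le.1 h0).1 (abs_le.1 h0).2
  have h1' : z 1 ^ 2 ≤ l ^ 2 := sq_le_sq' (abs_le.1 h1).1 (abs_le.1 h1).2
  suffices h : min |z 2| (ε⁻¹ ^ 2 * z 2 ^ 2) ≤ 9 * l ^ 2 by nlinarith
  rcases le_total ε l with h | h
  · exact (min_le_left _ _).trans (by nlinarith)
  · refine (min_le_right _ _).trans ?_
    rw [← mul_pow, ← sq_abs, abs_mul, abs_of_pos (inv_pos.2 hε)]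
    have h3 : ε⁻¹ * |z 2| ≤ 3 * l := by
      rw [inv_mul_le_iff₀ hε]
      nlinarith
    calc (ε⁻¹ * |z 2|) ^ 2 ≤ (3 * l) ^ 2 := by gcongr
      _ = 9 * l ^ 2 := by ring

lemma hdGeps_le_length {ε : ℝ} (hε : 0 < ε) {γ : ℝ → Fin 3 → ℝ} {a : Fin 3 → ℝ → ℝ} {L : NNReal}
    (hL : LipschitzOnWith L γ (Icc 0 1))
    (hd : ∀ᵐ t ∂(volume.restrict (Icc (0 : ℝ) 1)),
      HasDerivAt γ (a 0 t • hX1 (γ t) + a 1 t • hX2 (γ t) + a 2 t • hX3 (γ t)) t) :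
    hdGeps ε (γ 0) (γ 1) ≤ 4 * ∫ t in (0:ℝ)..1, hSpeed ε a t := by
  simp only [hasDerivAt_frame_iff] at hd
  rw [← uIcc_of_le zero_le_one] at hL
  have hac := hL.absolutelyContinuousOnInterval_apply
  -- `w` is the vertical coordinate of the left translate of `γ` that starts at the origin
  set w : ℝ → ℝ := fun t => γ t 2 + γ 0 1 * γ t 0 - γ 0 0 * γ t 1 with hw
  have hwac : AbsolutelyContinuousOnInterval w 0 1 :=
    ((hac 2).add ((hac 0).const_mul (γ 0 1))).sub ((hac 1).const_mul (γ 0 0))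
  have hwd : ∀ᵐ t ∂(volume.restrict (Icc (0 : ℝ) 1)),
      deriv w t = a 2 t - (γ t 1 - γ 0 1) * a 0 t + (γ t 0 - γ 0 0) * a 1 t := by
    filter_upwards [hd] with t ⟨h0, h1, h2⟩
    refine HasDerivAt.deriv ?_
    convert! (h2.add (h0.const_mul (γ 0 1))).sub (h1.const_mul (γ 0 0)) using 1
    ring
  have hIcc : volume.restrict (Icc (0 : ℝ) 1) = volume.restrict (uIoc 0 1) := by
    rw [uIoc_of_le zero_le_one, restrict_Ioc_eq_restrict_Icc]
  have hi0 : IntervalIntegrable (a 0) volume 0 1 :=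
    (hac 0).intervalIntegrable_deriv.congr_ae <| by
      rw [← hIcc]; filter_upwards [hd] with t h using h.1.deriv
  have hi1 : IntervalIntegrable (a 1) volume 0 1 :=
    (hac 1).intervalIntegrable_deriv.congr_ae <| by
      rw [← hIcc]; filter_upwards [hd] with t h using h.2.1.deriv
  have hi2 : IntervalIntegrable (a 2) volume 0 1 := by
    have h := (hwac.intervalIntegrable_deriv.add
      (hi0.continuousOn_mul ((hac 1).continuousOn.sub (continuousOn_const (c := γ 0 1))))).sub
      (hi1.continuousOn_mul ((hac 0).continuousOn.sub (continuousOn_const (c := γ 0 0))))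
    refine h.congr_ae ?_
    rw [← hIcc]
    filter_upwards [hwd] with t h
    simp only [Pi.sub_apply, h]
    ring
  have his : IntervalIntegrable (hSpeed ε a) volume 0 1 := by
    refine ((hi0.abs.add hi1.abs).add (hi2.abs.const_mul ε⁻¹)).mono_fun ?_ (ae_of_all _ fun t => ?_)
    · have m0 := hi0.aestronglyMeasurable_restrict_uIoc.aemeasurable
      have m1 := hi1.aestronglyMeasurable_restrict_uIoc.aemeasurable
      have m2 := hi2.aestronglyMeasurable_restrict_uIoc.aemeasurable
      exact (((m0.pow_const 2).add (m1.pow_const 2)).add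
        ((m2.pow_const 2).const_mul _)).sqrt.aestronglyMeasurable
    · have hε' := inv_pos.2 hε
      beta_reduce
      rw [Real.norm_of_nonneg (hSpeed_nonneg ε a t)]
      refine le_trans ?_ (le_abs_self _)
      refine Real.sqrt_le_iff.2 ⟨by positivity, ?_⟩
      rw [← sq_abs (a 0 t), ← sq_abs (a 1 t), ← sq_abs (a 2 t)]
      have p := abs_nonneg (a 0 t)
      have q := abs_nonneg (a 1 t)
      have r := mul_nonneg hε'.le (abs_nonneg (a 2 t))
      nlinarith [mul_nonneg p q, mul_nonneg p r, mul_nonneg q r]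
  set l := ∫ t in (0:ℝ)..1, hSpeed ε a t with hl
  have hsub : ∀ i, (∀ᵐ t ∂(volume.restrict (Icc (0 : ℝ) 1)),
      |deriv (fun τ => γ τ i) t| ≤ hSpeed ε a t) → ∀ t ∈ Icc (0 : ℝ) 1, |γ t i - γ 0 i| ≤ l := by
    intro i hi t ht
    have hss : uIcc 0 t ⊆ uIcc (0 : ℝ) 1 := by
      rw [uIcc_of_le ht.1, uIcc_of_le zero_le_one]
      exact Icc_subset_Icc_right ht.2
    refine (((hac i).mono hss).abs_sub_le_integral ht.1 (his.mono_set hss)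
      (ae_restrict_of_ae_restrict_of_subset (Icc_subset_Icc_right ht.2) hi)).trans ?_
    exact intervalIntegral.integral_mono_interval le_rfl ht.1 ht.2
      (ae_of_all _ (hSpeed_nonneg ε a)) his
  have hb0 := hsub 0 (by
    filter_upwards [hd] with t h
    rw [h.1.deriv]
    exact abs_zero_le_hSpeed ε a t)
  have hb1 := hsub 1 (by
    filter_upwards [hd] with t h
    rw [h.2.1.deriv]
    exact abs_one_le_hSpeed ε a t)
  have hl0 : 0 ≤ l := (abs_nonneg _).trans (hb0 1 (by simp))
  have hbw : |w 1 - w 0| ≤ (ε + 2 * l) * l := by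
    rw [hl, ← intervalIntegral.integral_const_mul, ← hl]
    refine hwac.abs_sub_le_integral zero_le_one (his.const_mul _) ?_
    filter_upwards [hwd, ae_restrict_mem measurableSet_Icc] with t h ht
    rw [h]
    have e0 : |(γ t 1 - γ 0 1) * a 0 t| ≤ l * hSpeed ε a t := by
      rw [abs_mul]
      exact mul_le_mul (hb1 t ht) (abs_zero_le_hSpeed ε a t) (abs_nonneg _) hl0
    have e1 : |(γ t 0 - γ 0 0) * a 1 t| ≤ l * hSpeed ε a t := by
      rw [abs_mul]
      exact mul_le_mul (hb0 t ht) (abs_one_le_hSpeed ε a t) (abs_nonneg _) hl0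
    have e2 := abs_two_le_hSpeed hε a t
    rw [abs_le] at *
    constructor <;> linarith [e0.1, e0.2, e1.1, e1.2, e2.1, e2.2]
  refine hNeps_le hε hl0 ?_ ?_ ?_
  · rw [← abs_neg]
    convert hb0 1 (by simp) using 2
    simp [hMul, hInv]
    ring
  · rw [← abs_neg]
    convert hb1 1 (by simp) using 2
    simp [hMul, hInv]
    ring
  · rw [← abs_neg]
    convert hbw using 2
    simp [hMul, hInv, hw]
    ring

/-- The lengths of the admissible curves from `x` to `y`. -/
def hLengths (ε : ℝ) (x y : Fin 3 → ℝ) : Set ℝ :=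
  {ℓ : ℝ | ∃ γ : ℝ → Fin 3 → ℝ, ∃ a : Fin 3 → ℝ → ℝ,
    γ 0 = x ∧ γ 1 = y ∧ (∃ L, LipschitzOnWith L γ (Set.Icc 0 1)) ∧
    (∀ᵐ t ∂(volume.restrict (Set.Icc (0 : ℝ) 1)),
      HasDerivAt γ (a 0 t • hX1 (γ t) + a 1 t • hX2 (γ t) + a 2 t • hX3 (γ t)) t) ∧
    ℓ = ∫ t in (0:ℝ)..1, hSpeed ε a t}

lemma dHeps_eq_sInf_hLengths (ε : ℝ) (x y : Fin 3 → ℝ) : dHeps ε x y = sInf (hLengths ε x y) := rfl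

/-- The curve obtained from a straight segment by adding closed polynomial loops of amplitudes
`c` and `d` in the two horizontal coordinates; the loops have zero mean, so the vertical
displacement gained is `-cd/35`. -/
lemma exists_mem_hLengths_le {ε M α β c d e : ℝ} {x y : Fin 3 → ℝ}
    (h0 : y 0 = x 0 + α) (h1 : y 1 = x 1 + β)
    (h2 : y 2 = x 2 - x 1 * α + x 0 * β + e - c * d / 35)
    (hM : ∀ p q : ℝ, |p| ≤ 1 → |q| ≤ 3 / 2 →
      (α + c * p) ^ 2 + (β + d * q) ^ 2 + ε⁻¹ ^ 2 * e ^ 2 ≤ M ^ 2) (hM0 : 0 ≤ M) :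
    ∃ l ∈ hLengths ε x y, l ≤ M := by
  let u : ℝ → ℝ := fun t => α * t + c * (t - 3 * t ^ 2 + 2 * t ^ 3)
  let v : ℝ → ℝ := fun t => β * t + d * (t - 6 * t ^ 2 + 10 * t ^ 3 - 5 * t ^ 4)
  let w : ℝ → ℝ := fun t => e * t + α * d * (-2 * t ^ 3 + 5 * t ^ 4 - 3 * t ^ 5)
    + β * c * (t ^ 3 - t ^ 4)
    + c * d * (-t ^ 3 + 4 * t ^ 4 - 33 / 5 * t ^ 5 + 5 * t ^ 6 - 10 / 7 * t ^ 7)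
  let u' : ℝ → ℝ := fun t => α + c * (1 - 6 * t + 6 * t ^ 2)
  let v' : ℝ → ℝ := fun t => β + d * (1 - 12 * t + 30 * t ^ 2 - 20 * t ^ 3)
  have hpow : ∀ (n : ℕ) (t : ℝ), HasDerivAt (fun τ : ℝ => τ ^ n) (n * t ^ (n - 1)) t :=
    fun n t => hasDerivAt_pow n t
  have hu : ∀ t, HasDerivAt u (u' t) t := fun t => by
    convert! ((hasDerivAt_id t).const_mul α).add ((((hasDerivAt_id t).sub
      ((hpow 2 t).const_mul 3)).add ((hpow 3 t).const_mul 2)).const_mul c) using 1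
    simp [u', -mul_eq_mul_left_iff]; ring
  have hv : ∀ t, HasDerivAt v (v' t) t := fun t => by
    convert! ((hasDerivAt_id t).const_mul β).add (((((hasDerivAt_id t).sub
      ((hpow 2 t).const_mul 6)).add ((hpow 3 t).const_mul 10)).sub
      ((hpow 4 t).const_mul 5)).const_mul d) using 1
    simp [v', -mul_eq_mul_left_iff]; ring
  have hw : ∀ t, HasDerivAt w (e - v t * u' t + u t * v' t) t := fun t => by
    convert! ((((hasDerivAt_id t).const_mul e).add (((((hpow 3 t).const_mul (-2)).add
      ((hpow 4 t).const_mul 5)).sub ((hpow 5 t).const_mul 3)).const_mul (α * d))).add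
      (((hpow 3 t).sub (hpow 4 t)).const_mul (β * c))).add
      ((((((hpow 3 t).neg.add ((hpow 4 t).const_mul 4)).sub ((hpow 5 t).const_mul (33 / 5))).add
      ((hpow 6 t).const_mul 5)).sub ((hpow 7 t).const_mul (10 / 7))).const_mul (c * d)) using 1
    simp [u, v, u', v']; ring
  let γ : ℝ → Fin 3 → ℝ := fun t =>
    ![x 0 + u t, x 1 + v t, x 2 + w t - x 1 * u t + x 0 * v t]
  let a : Fin 3 → ℝ → ℝ := ![u', v', fun _ => e]
  have hγ : ∀ t, HasDerivAt γ (a 0 t • hX1 (γ t) + a 1 t • hX2 (γ t) + a 2 t • hX3 (γ t)) t := by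
    intro t
    rw [hasDerivAt_frame_iff]
    refine ⟨(hu t).const_add _, (hv t).const_add _, ?_⟩
    convert! (((hw t).const_add (x 2)).sub ((hu t).const_mul (x 1))).add
      ((hv t).const_mul (x 0)) using 1
    simp [γ, a]; ring
  have hγC : ContDiff ℝ 1 γ := by
    rw [contDiff_pi]
    intro i
    fin_cases i <;> simp [γ, u, v, w] <;> fun_prop
  refine ⟨_, ⟨γ, a, ?_, ?_, ?_, ae_of_all _ hγ, rfl⟩, ?_⟩
  · ext i; fin_cases i <;> simp [γ, u, v, w]
  · ext i; fin_cases i <;> simp [γ, u, v, w, h0, h1, h2, -mul_eq_zero] <;> ring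
  · exact hγC.locallyLipschitz.locallyLipschitzOn.exists_lipschitzOnWith_of_compact isCompact_Icc
  · have hb : ∀ t ∈ uIoc (0 : ℝ) 1, ‖hSpeed ε a t‖ ≤ M := by
      intro t ht
      rw [uIoc_of_le zero_le_one] at ht
      have ht1 : 0 ≤ t := ht.1.le
      have hs0 : 0 ≤ t * (1 - t) := mul_nonneg ht1 (by linarith [ht.2])
      have hs1 : t * (1 - t) ≤ 1 / 4 := by nlinarith [sq_nonneg (1 - 2 * t)]
      have hp : |1 - 6 * t + 6 * t ^ 2| ≤ 1 := abs_le.2 ⟨by linarith, by linarith⟩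
      have hq : |1 - 12 * t + 30 * t ^ 2 - 20 * t ^ 3| ≤ 3 / 2 := by
        have e : 1 - 12 * t + 30 * t ^ 2 - 20 * t ^ 3 = (1 - 2 * t) * (1 - 10 * (t * (1 - t))) := by
          ring
        have e1 : |1 - 2 * t| ≤ 1 := abs_le.2 ⟨by linarith [ht.2], by linarith⟩
        have e2 : |1 - 10 * (t * (1 - t))| ≤ 3 / 2 := abs_le.2 ⟨by linarith, by linarith⟩
        rw [e, abs_mul, ← one_mul (3 / 2 : ℝ)]
        exact mul_le_mul e1 e2 (abs_nonneg _) zero_le_one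
      rw [Real.norm_of_nonneg (hSpeed_nonneg ε a t)]
      refine Real.sqrt_le_iff.2 ⟨hM0, hM _ _ hp hq⟩
    have h := intervalIntegral.norm_integral_le_of_norm_le_const hb
    rw [sub_zero, abs_one, mul_one] at h
    exact (le_abs_self _).trans h

lemma exists_mem_hLengths_le_gauge (ε : ℝ) (x y : Fin 3 → ℝ) :
    ∃ l ∈ hLengths ε x y, l ≤ 16 * hdGeps ε x y := by
  set z := hMul (hInv y) x with hz
  have hz0 : y 0 = x 0 + -z 0 := by simp [hz, hMul, hInv]
  have hz1 : y 1 = x 1 + -z 1 := by simp [hz, hMul, hInv]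
  have hz2 : y 2 = x 2 - x 1 * -z 0 + x 0 * -z 1 - z 2 := by simp [hz, hMul, hInv]; ring
  have hn : 0 ≤ ε⁻¹ ^ 2 * z 2 ^ 2 := by positivity
  have hN : (16 * hdGeps ε x y) ^ 2
      = 256 * (z 0 ^ 2 + z 1 ^ 2 + min |z 2| (ε⁻¹ ^ 2 * z 2 ^ 2)) := by
    rw [hdGeps, hNeps, mul_pow, Real.sq_sqrt (by positivity), ← hz]
    norm_num
  have hN0 : 0 ≤ 16 * hdGeps ε x y := mul_nonneg (by norm_num) (Real.sqrt_nonneg _)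
  rcases le_total |z 2| (ε⁻¹ ^ 2 * z 2 ^ 2) with h | h
  · rw [min_eq_left h] at hN
    obtain ⟨c, d, hcd, hc, hd⟩ : ∃ c d : ℝ, c * d = 35 * z 2 ∧ c ^ 2 = 35 * |z 2| ∧
        d ^ 2 = 35 * |z 2| := by
      have hs := Real.sq_sqrt (show 0 ≤ 35 * |z 2| by positivity)
      rcases abs_cases (z 2) with ⟨h', -⟩ | ⟨h', -⟩
      · exact ⟨√(35 * |z 2|), √(35 * |z 2|), by rw [← sq, hs, h'], hs, hs⟩
      · exact ⟨√(35 * |z 2|), -√(35 * |z 2|), by rw [mul_neg, ← sq, hs, h']; ring, hs,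
          by rw [neg_sq, hs]⟩
    refine exists_mem_hLengths_le (c := c) (d := d) (e := 0) hz0 hz1 (by rw [hz2, hcd]; ring) ?_ hN0
    intro p q hp hq
    rw [hN]
    have hp2 : p ^ 2 ≤ 1 := (sq_le_one_iff_abs_le_one p).2 hp
    have hq2 : q ^ 2 ≤ (3 / 2) ^ 2 := sq_le_sq' (abs_le.1 hq).1 (abs_le.1 hq).2
    have e1 : (c * p) ^ 2 ≤ 35 * |z 2| * 1 := by rw [mul_pow, hc]; gcongr
    have e2 : (d * q) ^ 2 ≤ 35 * |z 2| * (3 / 2) ^ 2 := by rw [mul_pow, hd]; gcongr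
    nlinarith [sq_nonneg (-z 0 - c * p), sq_nonneg (-z 1 - d * q), sq_nonneg (z 0),
      sq_nonneg (z 1), abs_nonneg (z 2)]
  · rw [min_eq_right h] at hN
    refine exists_mem_hLengths_le (c := 0) (d := 0) (e := -z 2) hz0 hz1 (by rw [hz2]; ring) ?_ hN0
    intro p q _ _
    rw [hN]
    nlinarith [sq_nonneg (z 0), sq_nonneg (z 1)]

/-- **Lemma (uniform equivalence of `d_ε` and the regularized gauge)**. -/
theorem heisenberg_gauge_eps_equiv :
    ∃ A : ℝ, 0 < A ∧ ∀ ε : ℝ, 0 < ε → ∀ x y : Fin 3 → ℝ,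
      A⁻¹ * hdGeps ε x y ≤ dHeps ε x y ∧ dHeps ε x y ≤ A * hdGeps ε x y := by
  refine ⟨16, by norm_num, fun ε hε x y => ?_⟩
  obtain ⟨l, hl, hle⟩ := exists_mem_hLengths_le_gauge ε x y
  have hlow : ∀ b ∈ hLengths ε x y, (16 : ℝ)⁻¹ * hdGeps ε x y ≤ b := by
    rintro b ⟨γ, a, rfl, rfl, ⟨L, hL⟩, hd, rfl⟩
    have h := hdGeps_le_length hε hL hd
    have h0 : 0 ≤ hdGeps ε (γ 0) (γ 1) := Real.sqrt_nonneg _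
    linarith
  rw [dHeps_eq_sInf_hLengths]
  exact ⟨le_csInf ⟨l, hl⟩ hlow, (csInf_le ⟨_, hlow⟩ hl).trans hle⟩

end
end

section
/- In the first Heisenberg group the doubling property holds uniformly in ε: there exists a constant C > 0 such that for every ε > 0, every x ∈ ℝ³ and every r > 0, |B_ε(x, 2r)| ≤ C |B_ε(x, r)|, where B_ε(x,r) is the metric ball of the Riemannian distance d_ε and |E| is Lebesgue measure. -/
/-!
STATEMENT 9: In the first Heisenberg group the doubling property for the balls of the
Riemannian approximating distances `d_ε` holds uniformly in `ε > 0`.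
-/

open MeasureTheory Set

noncomputable section

/-- Metric ball of `d_ε`. -/
def hBallEps (ε : ℝ) (x : Fin 3 → ℝ) (r : ℝ) : Set (Fin 3 → ℝ) := {y | dHeps ε x y < r}

/-- The lengths of the Lipschitz curves joining `x` to `y`, whose infimum is `dHeps ε x y`. -/
def curveLengths (ε : ℝ) (x y : Fin 3 → ℝ) : Set ℝ :=
  {ℓ : ℝ | ∃ γ : ℝ → Fin 3 → ℝ, ∃ a : Fin 3 → ℝ → ℝ,
    γ 0 = x ∧ γ 1 = y ∧ (∃ L, LipschitzOnWith L γ (Set.Icc 0 1)) ∧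
    (∀ᵐ t ∂(volume.restrict (Set.Icc (0 : ℝ) 1)),
      HasDerivAt γ (a 0 t • hX1 (γ t) + a 1 t • hX2 (γ t) + a 2 t • hX3 (γ t)) t) ∧
    ℓ = ∫ t in (0:ℝ)..1, Real.sqrt (a 0 t ^ 2 + a 1 t ^ 2 + ε⁻¹ ^ 2 * a 2 t ^ 2)}

theorem bddBelow_curveLengths (ε : ℝ) (x y : Fin 3 → ℝ) : BddBelow (curveLengths ε x y) := by
  refine ⟨0, ?_⟩
  rintro ℓ ⟨γ, a, -, -, -, -, rfl⟩
  exact intervalIntegral.integral_nonneg zero_le_one fun t _ => Real.sqrt_nonneg _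

/-- The vertical coordinate of `x⁻¹ y`. -/
def vertDiff (x y : Fin 3 → ℝ) : ℝ :=
  y 2 - x 2 + x 1 * (y 0 - x 0) - x 0 * (y 1 - x 1)

/-- The left translate to `x` of the box with half-sides `A, A, H`. -/
def heisBox (x : Fin 3 → ℝ) (A H : ℝ) : Set (Fin 3 → ℝ) :=
  {y | |y 0 - x 0| < A ∧ |y 1 - x 1| < A ∧ |vertDiff x y| < H}

/-- The matrix of the differential of the left translation by `x⁻¹`. -/
def shearMatrix (x : Fin 3 → ℝ) : Matrix (Fin 3) (Fin 3) ℝ :=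
  !![1, 0, 0; 0, 1, 0; x 1, -x 0, 1]

theorem volume_heisBox (x : Fin 3 → ℝ) {A H : ℝ} (hA : 0 < A) :
    volume (heisBox x A H) = ENNReal.ofReal (8 * A ^ 2 * H) := by
  set L := Matrix.toLin' (shearMatrix x) with hL
  have hdet : LinearMap.det L = 1 := by
    rw [hL, LinearMap.det_toLin', shearMatrix, Matrix.det_fin_three]
    simp
  set S : Set (Fin 3 → ℝ) := Set.pi univ fun i => Ioo (![-A, -A, -H] i) (![A, A, H] i) with hS
  have hbox : heisBox x A H = (fun y => y - x) ⁻¹' (L ⁻¹' S) := by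
    ext y
    simp only [heisBox, vertDiff, hS, hL, shearMatrix, mem_ofPred_eq, mem_preimage, mem_pi, mem_univ,
      true_imp_iff, Fin.forall_fin_succ, abs_lt, mem_Ioo, Matrix.toLin'_apply, Matrix.mulVec,
      dotProduct, Fin.sum_univ_three]
    simp
    intros
    constructor <;> rintro ⟨_, _⟩ <;> constructor <;> linarith
  rw [hbox]
  have h1 : volume ((fun y => y - x) ⁻¹' (L ⁻¹' S)) = volume (L ⁻¹' S) := by
    simp only [sub_eq_add_neg]
    exact measure_preimage_add_right _ _ _
  rw [h1, Measure.addHaar_preimage_linearMap _ (by simp [hdet]), hdet, hS, Real.volume_pi_Ioo,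
    Fin.prod_univ_three]
  simp only [Matrix.cons_val]
  rw [← ENNReal.ofReal_mul (by linarith), ← ENNReal.ofReal_mul (by nlinarith),
    ← ENNReal.ofReal_mul (by positivity)]
  congr 1
  norm_num
  ring

/-- An explicit polynomial curve from `x` to `y` bounds the distance: `α`, `β` are the sizes of the
loops added to the two horizontal coordinates, `c` is the constant vertical speed. -/
theorem exists_curveLength_le {ε M α β c : ℝ} (x y : Fin 3 → ℝ) (hM : 0 ≤ M)
    (hy : vertDiff x y = α * (y 1 - x 1) / 3 - α * β / 15 + c)
    (hcost : (|y 0 - x 0| + |α|) ^ 2 + (|y 1 - x 1| + |β|) ^ 2 + ε⁻¹ ^ 2 * c ^ 2 ≤ M ^ 2) :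
    ∃ ℓ ∈ curveLengths ε x y, ℓ ≤ M := by
  set p := y 0 - x 0 with hp
  set q := y 1 - x 1 with hq
  let g0 : ℝ → ℝ := fun t => p * t + α * (t - t ^ 2)
  let g1 : ℝ → ℝ := fun t => q * t + β * (t - 3 * t ^ 2 + 2 * t ^ 3)
  let g2 : ℝ → ℝ := fun t => c * t + p * β * (t ^ 4 - t ^ 3) + α * q * t ^ 3 / 3 +
    α * β * (t ^ 4 - 2 / 3 * t ^ 3 - 2 / 5 * t ^ 5)
  let γ : ℝ → Fin 3 → ℝ := fun t =>
    ![x 0 + g0 t, x 1 + g1 t, x 2 + g2 t - (x 1 * g0 t - x 0 * g1 t)]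
  let a : Fin 3 → ℝ → ℝ := ![fun t => p + α * (1 - 2 * t),
    fun t => q + β * (1 - 6 * t + 6 * t ^ 2), fun _ => c]
  have hγ : ContDiff ℝ 1 γ := by
    rw [contDiff_pi]
    intro i
    fin_cases i <;> simp [γ, g0, g1, g2] <;> fun_prop
  refine ⟨_, ⟨γ, a, ?_, ?_, ?_, ?_, rfl⟩, ?_⟩
  · ext i
    fin_cases i <;> simp [γ, g0, g1, g2]
  · ext i
    simp only [vertDiff, ← hp, ← hq] at hy
    fin_cases i
    · simp [γ, g0, hp]
    · simp [γ, g1, hq]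
      norm_num
    · simp [γ, g0, g1, g2]
      linear_combination -hy
  · exact hγ.contDiffOn.exists_lipschitzOnWith one_ne_zero (convex_Icc 0 1) isCompact_Icc
  · refine Filter.Eventually.of_forall fun t => ?_
    have h0 : HasDerivAt g0 (p + α * (1 - 2 * t)) t := by
      have := ((hasDerivAt_id t).const_mul p).add
        (((hasDerivAt_id t).sub (hasDerivAt_pow 2 t)).const_mul α)
      exact this.congr_deriv (by norm_num)
    have h1 : HasDerivAt g1 (q + β * (1 - 6 * t + 6 * t ^ 2)) t := by
      have := ((hasDerivAt_id t).const_mul q).add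
        ((((hasDerivAt_id t).sub ((hasDerivAt_pow 2 t).const_mul 3)).add
          ((hasDerivAt_pow 3 t).const_mul 2)).const_mul β)
      exact this.congr_deriv (by push_cast; ring)
    have h2 : HasDerivAt g2 (c + g0 t * (q + β * (1 - 6 * t + 6 * t ^ 2))
        - g1 t * (p + α * (1 - 2 * t))) t := by
      have := ((((hasDerivAt_id t).const_mul c).add
        (((hasDerivAt_pow 4 t).sub (hasDerivAt_pow 3 t)).const_mul (p * β))).add
        (((hasDerivAt_pow 3 t).const_mul (α * q)).div_const 3)).add
        ((((hasDerivAt_pow 4 t).sub ((hasDerivAt_pow 3 t).const_mul (2 / 3))).sub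
          ((hasDerivAt_pow 5 t).const_mul (2 / 5))).const_mul (α * β))
      exact this.congr_deriv (by simp only [g0, g1]; norm_num; ring)
    rw [hasDerivAt_pi]
    intro i
    fin_cases i
    · simpa [γ, a, hX1, hX2, hX3] using h0
    · simpa [γ, a, hX1, hX2, hX3] using h1
    · have := (h2.const_add (x 2)).sub ((h0.const_mul (x 1)).sub (h1.const_mul (x 0)))
      refine this.congr_deriv ?_
      simp [γ, a, hX1, hX2, hX3]
      ring
  · have hbound : ∀ t ∈ Icc (0 : ℝ) 1,
        Real.sqrt (a 0 t ^ 2 + a 1 t ^ 2 + ε⁻¹ ^ 2 * a 2 t ^ 2) ≤ M := by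
      rintro t ⟨ht0, ht1⟩
      rw [Real.sqrt_le_left hM]
      refine le_trans ?_ hcost
      have b0 : |p + α * (1 - 2 * t)| ≤ |p| + |α| := by
        refine (abs_add_le _ _).trans (add_le_add le_rfl ?_)
        rw [abs_mul]
        exact mul_le_of_le_one_right (abs_nonneg _) (abs_le.2 ⟨by linarith, by linarith⟩)
      have b1 : |q + β * (1 - 6 * t + 6 * t ^ 2)| ≤ |q| + |β| := by
        refine (abs_add_le _ _).trans (add_le_add le_rfl ?_)
        rw [abs_mul]
        exact mul_le_of_le_one_right (abs_nonneg _)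
          (abs_le.2 ⟨by nlinarith [sq_nonneg (2 * t - 1)], by nlinarith⟩)
      have s0 := pow_le_pow_left₀ (abs_nonneg _) b0 2
      have s1 := pow_le_pow_left₀ (abs_nonneg _) b1 2
      rw [sq_abs] at s0 s1
      simp only [a, Matrix.cons_val]
      linarith
    have hcont : Continuous fun t => Real.sqrt (a 0 t ^ 2 + a 1 t ^ 2 + ε⁻¹ ^ 2 * a 2 t ^ 2) := by
      simp only [a, Matrix.cons_val]
      fun_prop
    calc _ ≤ ∫ _ in (0 : ℝ)..1, M := intervalIntegral.integral_mono_on zero_le_one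
          (hcont.intervalIntegrable _ _) intervalIntegrable_const hbound
      _ = M := by simp

theorem curveLengths_nonempty (ε : ℝ) (x y : Fin 3 → ℝ) : (curveLengths ε x y).Nonempty := by
  set K := |y 0 - x 0| ^ 2 + |y 1 - x 1| ^ 2 + ε⁻¹ ^ 2 * vertDiff x y ^ 2
  obtain ⟨ℓ, hℓ, -⟩ := exists_curveLength_le (ε := ε) (M := √K) (α := 0) (β := 0)
    (c := vertDiff x y) x y (Real.sqrt_nonneg _) (by ring)
    (by rw [Real.sq_sqrt (by positivity)]; simp [K])
  exact ⟨ℓ, hℓ⟩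

theorem mem_hBallEps_of_cost {ε M r α β c : ℝ} (x y : Fin 3 → ℝ) (hM : 0 ≤ M) (hMr : M < r)
    (hy : vertDiff x y = α * (y 1 - x 1) / 3 - α * β / 15 + c)
    (hcost : (|y 0 - x 0| + |α|) ^ 2 + (|y 1 - x 1| + |β|) ^ 2 + ε⁻¹ ^ 2 * c ^ 2 ≤ M ^ 2) :
    y ∈ hBallEps ε x r := by
  obtain ⟨ℓ, hℓ, hℓM⟩ := exists_curveLength_le x y hM hy hcost
  exact ((csInf_le (bddBelow_curveLengths ε x y) hℓ).trans hℓM).trans_lt hMr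

theorem heisBox_subset_hBallEps_riemannian {ε r : ℝ} (hε : 0 < ε) (hr : 0 < r) (x : Fin 3 → ℝ) :
    heisBox x (r / 2) (ε * r / 2) ⊆ hBallEps ε x r := by
  rintro y ⟨h0, h1, h2⟩
  refine mem_hBallEps_of_cost (M := 9 / 10 * r) (α := 0) (β := 0) (c := vertDiff x y) x y
    (by positivity) (by linarith) (by ring) ?_
  have s0 := pow_le_pow_left₀ (abs_nonneg _) h0.le 2
  have s1 := pow_le_pow_left₀ (abs_nonneg _) h1.le 2
  have s2 := pow_le_pow_left₀ (abs_nonneg _) h2.le 2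
  have s3 : ε⁻¹ ^ 2 * vertDiff x y ^ 2 ≤ r ^ 2 / 4 := by
    rw [sq_abs] at s2
    calc ε⁻¹ ^ 2 * vertDiff x y ^ 2 ≤ ε⁻¹ ^ 2 * (ε * r / 2) ^ 2 := by gcongr
      _ = r ^ 2 / 4 := by field_simp; norm_num
  simp only [abs_zero, add_zero]
  nlinarith

theorem heisBox_subset_hBallEps_horizontal (ε : ℝ) {r : ℝ} (hr : 0 < r) (x : Fin 3 → ℝ) :
    heisBox x (r / 100) (r ^ 2 / 1000) ⊆ hBallEps ε x r := by
  rintro y ⟨h0, h1, h2⟩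
  set β := 5 * (y 1 - x 1) - 60 * vertDiff x y / r with hβ
  refine mem_hBallEps_of_cost (M := 9 / 10 * r) (α := r / 4) (β := β) (c := 0) x y
    (by positivity) (by linarith) (by rw [hβ]; field_simp; ring) ?_
  have hβ' : |β| ≤ 12 / 100 * r := by
    have e1 : |60 * vertDiff x y / r| ≤ 6 / 100 * r := by
      rw [abs_div, abs_of_pos hr, div_le_iff₀ hr, abs_mul, abs_of_pos (by norm_num : (0 : ℝ) < 60)]
      nlinarith
    have e2 : |5 * (y 1 - x 1)| ≤ 5 / 100 * r := by
      rw [abs_mul, abs_of_pos (by norm_num : (0 : ℝ) < 5)]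
      linarith
    have := abs_sub (5 * (y 1 - x 1)) (60 * vertDiff x y / r)
    linarith
  have e0 : |y 0 - x 0| + |r / 4| ≤ r / 2 := by
    rw [abs_of_pos (by positivity : 0 < r / 4)]; linarith
  have e1 : |y 1 - x 1| + |β| ≤ r / 2 := by linarith
  have s0 := pow_le_pow_left₀ (by positivity) e0 2
  have s1 := pow_le_pow_left₀ (by positivity) e1 2
  nlinarith

/-- The fundamental theorem of calculus for a Lipschitz function with a prescribed a.e. derivative. -/
theorem LipschitzOnWith.integral_eq_sub_of_ae_hasDerivAt {f f' : ℝ → ℝ} {K : NNReal}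
    (hf : LipschitzOnWith K f (Icc 0 1))
    (hf' : ∀ᵐ t ∂(volume.restrict (Icc (0 : ℝ) 1)), HasDerivAt f (f' t) t) :
    IntegrableOn f' (Icc 0 1) ∧ ∀ t ∈ Icc (0 : ℝ) 1, ∫ s in (0 : ℝ)..t, f' s = f t - f 0 := by
  have hac : AbsolutelyContinuousOnInterval f 0 1 :=
    LipschitzOnWith.absolutelyContinuousOnInterval (K := K) (by rwa [uIcc_of_le zero_le_one])
  have hae : deriv f =ᵐ[volume.restrict (Icc (0 : ℝ) 1)] f' := hf'.mono fun t ht => ht.deriv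
  constructor
  · have := hac.intervalIntegrable_deriv
    rw [intervalIntegrable_iff_integrableOn_Icc_of_le zero_le_one] at this
    exact this.congr hae
  · intro t ht
    have hact : AbsolutelyContinuousOnInterval f 0 t :=
      hac.mono (by rw [uIcc_of_le ht.1, uIcc_of_le zero_le_one]; exact Icc_subset_Icc_right ht.2)
    rw [← hact.integral_deriv_eq_sub]
    refine intervalIntegral.integral_congr_ae_restrict ?_
    rw [uIoc_of_le ht.1]
    exact Filter.EventuallyEq.symm (ae_restrict_of_ae_restrict_of_subset
      (Ioc_subset_Icc_self.trans (Icc_subset_Icc_right ht.2)) hae)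

theorem abs_intervalIntegral_le_of_ae_abs_le {f g : ℝ → ℝ} {t : ℝ} (ht : t ∈ Icc (0 : ℝ) 1)
    (hg : IntegrableOn g (Icc 0 1))
    (hg0 : ∀ s, 0 ≤ g s) (hfg : ∀ᵐ s ∂(volume.restrict (Icc (0 : ℝ) 1)), |f s| ≤ g s) :
    |∫ s in (0 : ℝ)..t, f s| ≤ ∫ s in (0 : ℝ)..1, g s := by
  have hgi : IntervalIntegrable g volume 0 1 := by
    rwa [intervalIntegrable_iff_integrableOn_Icc_of_le zero_le_one]
  have hsub : Ioc 0 t ⊆ Icc (0 : ℝ) 1 := Ioc_subset_Icc_self.trans (Icc_subset_Icc_right ht.2)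
  have hgt : IntervalIntegrable g volume 0 t := hgi.mono_set (by
    rw [uIcc_of_le ht.1, uIcc_of_le zero_le_one]; exact Icc_subset_Icc_right ht.2)
  have h1 : |∫ s in (0 : ℝ)..t, f s| ≤ ∫ s in (0 : ℝ)..t, g s := by
    rw [← Real.norm_eq_abs]
    refine intervalIntegral.norm_integral_le_of_norm_le ht.1 ?_ hgt
    exact (ae_restrict_iff' measurableSet_Ioc).1 (ae_restrict_of_ae_restrict_of_subset hsub hfg)
  exact h1.trans (intervalIntegral.integral_mono_interval le_rfl ht.1 ht.2
    (Filter.Eventually.of_forall hg0) hgi)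

theorem hBallEps_subset_heisBox {ε R : ℝ} (hε : 0 < ε) (x : Fin 3 → ℝ) :
    hBallEps ε x R ⊆ heisBox x R (ε * R + 2 * R ^ 2) := by
  intro y hy
  obtain ⟨ℓ, ⟨γ, a, hγ0, hγ1, ⟨K, hK⟩, hder, rfl⟩, hℓ⟩ :=
    exists_lt_of_csInf_lt (curveLengths_nonempty ε x y) (show sInf (curveLengths ε x y) < R from hy)
  set N : ℝ → ℝ := fun t => Real.sqrt (a 0 t ^ 2 + a 1 t ^ 2 + ε⁻¹ ^ 2 * a 2 t ^ 2) with hN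
  have hN0 : ∀ t, 0 ≤ N t := fun t => Real.sqrt_nonneg _
  have hlip : ∀ i, LipschitzOnWith K (fun t => γ t i) (Icc 0 1) := fun i =>
    LipschitzOnWith.of_dist_le_mul fun s hs t ht =>
      (dist_le_pi_dist _ _ i).trans (hK.dist_le_mul s hs t ht)
  have hd0 : ∀ᵐ t ∂(volume.restrict (Icc (0 : ℝ) 1)), HasDerivAt (fun s => γ s 0) (a 0 t) t :=
    hder.mono fun t ht => by simpa [hX1, hX2, hX3] using hasDerivAt_pi.1 ht 0
  have hd1 : ∀ᵐ t ∂(volume.restrict (Icc (0 : ℝ) 1)), HasDerivAt (fun s => γ s 1) (a 1 t) t :=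
    hder.mono fun t ht => by simpa [hX1, hX2, hX3] using hasDerivAt_pi.1 ht 1
  have hd2 : ∀ᵐ t ∂(volume.restrict (Icc (0 : ℝ) 1)),
      HasDerivAt (fun s => γ s 2) (a 2 t + a 1 t * γ t 0 - a 0 t * γ t 1) t :=
    hder.mono fun t ht => (hasDerivAt_pi.1 ht 2).congr_deriv (by simp [hX1, hX2, hX3]; ring)
  obtain ⟨i0, e0⟩ := (hlip 0).integral_eq_sub_of_ae_hasDerivAt hd0
  obtain ⟨i1, e1⟩ := (hlip 1).integral_eq_sub_of_ae_hasDerivAt hd1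
  obtain ⟨i2, e2⟩ := (hlip 2).integral_eq_sub_of_ae_hasDerivAt hd2
  have i3 : IntegrableOn (a 2) (Icc 0 1) := by
    have m1 := i1.mul_continuousOn (hlip 0).continuousOn isCompact_Icc
    have m0 := i0.mul_continuousOn (hlip 1).continuousOn isCompact_Icc
    refine ((i2.sub m1).add m0).congr (Filter.Eventually.of_forall fun t => ?_)
    simp only [Pi.add_apply, Pi.sub_apply]
    ring
  have hNint : IntegrableOn N (Icc 0 1) := by
    refine Integrable.mono' ((i0.abs.add i1.abs).add (i3.abs.const_mul ε⁻¹)) ?_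
      (Filter.Eventually.of_forall fun t => ?_)
    · exact (((i0.aemeasurable.pow_const 2).add (i1.aemeasurable.pow_const 2)).add
        ((i3.aemeasurable.pow_const 2).const_mul _)).sqrt.aestronglyMeasurable
    · rw [Real.norm_of_nonneg (hN0 t)]
      have hε' := inv_pos.2 hε
      simp only [hN, Pi.add_apply]
      rw [Real.sqrt_le_left (by positivity), ← sq_abs (a 0 t), ← sq_abs (a 1 t), ← sq_abs (a 2 t)]
      have p0 := abs_nonneg (a 0 t)
      have p1 := abs_nonneg (a 1 t)
      have p2 : 0 ≤ ε⁻¹ * |a 2 t| := by positivity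
      nlinarith [mul_nonneg p0 p1, mul_nonneg p0 p2, mul_nonneg p1 p2]
  have b0 : ∀ t, |a 0 t| ≤ N t := fun t => Real.abs_le_sqrt (by
    nlinarith [sq_nonneg (a 1 t), sq_nonneg (ε⁻¹ * a 2 t)])
  have b1 : ∀ t, |a 1 t| ≤ N t := fun t => Real.abs_le_sqrt (by
    nlinarith [sq_nonneg (a 0 t), sq_nonneg (ε⁻¹ * a 2 t)])
  have b2 : ∀ t, |a 2 t| ≤ ε * N t := fun t => by
    have : |ε⁻¹ * a 2 t| ≤ N t := Real.abs_le_sqrt (by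
      nlinarith [sq_nonneg (a 0 t), sq_nonneg (a 1 t)])
    rwa [abs_mul, abs_of_pos (inv_pos.2 hε), inv_mul_le_iff₀ hε] at this
  have hR : 0 < R := (intervalIntegral.integral_nonneg zero_le_one fun t _ => hN0 t).trans_lt hℓ
  have c0 : ∀ t ∈ Icc (0 : ℝ) 1, |γ t 0 - x 0| < R := fun t ht => by
    rw [← hγ0, ← e0 t ht]
    exact (abs_intervalIntegral_le_of_ae_abs_le ht hNint hN0
      (Filter.Eventually.of_forall b0)).trans_lt hℓ
  have c1 : ∀ t ∈ Icc (0 : ℝ) 1, |γ t 1 - x 1| < R := fun t ht => by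
    rw [← hγ0, ← e1 t ht]
    exact (abs_intervalIntegral_le_of_ae_abs_le ht hNint hN0
      (Filter.Eventually.of_forall b1)).trans_lt hℓ
  have h1m : (1 : ℝ) ∈ Icc (0 : ℝ) 1 := ⟨zero_le_one, le_rfl⟩
  refine ⟨hγ1 ▸ c0 1 h1m, hγ1 ▸ c1 1 h1m, ?_⟩
  have toII : ∀ {f : ℝ → ℝ}, IntegrableOn f (Icc 0 1) → IntervalIntegrable f volume 0 1 :=
    fun h => (intervalIntegrable_iff_integrableOn_Icc_of_le zero_le_one).2 h
  have hv : vertDiff x y = ∫ t in (0 : ℝ)..1,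
      (a 2 t + a 1 t * γ t 0 - a 0 t * γ t 1 + x 1 * a 0 t - x 0 * a 1 t) := by
    rw [intervalIntegral.integral_sub (((toII i2).add ((toII i0).const_mul _)))
      ((toII i1).const_mul _), intervalIntegral.integral_add (toII i2) ((toII i0).const_mul _),
      intervalIntegral.integral_const_mul, intervalIntegral.integral_const_mul, e0 1 h1m, e1 1 h1m,
      e2 1 h1m, hγ0, hγ1, vertDiff]
  rw [hv]
  have hfinal := abs_intervalIntegral_le_of_ae_abs_le (g := fun t => (ε + 2 * R) * N t)
    (f := fun t => a 2 t + a 1 t * γ t 0 - a 0 t * γ t 1 + x 1 * a 0 t - x 0 * a 1 t)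
    h1m (hNint.const_mul _) (fun t => mul_nonneg (by positivity) (hN0 t)) (by
      refine (ae_restrict_iff' measurableSet_Icc).2 (Filter.Eventually.of_forall fun t ht => ?_)
      have r : a 2 t + a 1 t * γ t 0 - a 0 t * γ t 1 + x 1 * a 0 t - x 0 * a 1 t =
        a 2 t + a 1 t * (γ t 0 - x 0) - a 0 t * (γ t 1 - x 1) := by ring
      rw [r]
      have k1 : |a 1 t * (γ t 0 - x 0)| ≤ N t * R := by
        rw [abs_mul]; exact mul_le_mul (b1 t) (c0 t ht).le (abs_nonneg _) (hN0 t)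
      have k0 : |a 0 t * (γ t 1 - x 1)| ≤ N t * R := by
        rw [abs_mul]; exact mul_le_mul (b0 t) (c1 t ht).le (abs_nonneg _) (hN0 t)
      have := abs_sub (a 2 t + a 1 t * (γ t 0 - x 0)) (a 0 t * (γ t 1 - x 1))
      have := abs_add_le (a 2 t) (a 1 t * (γ t 0 - x 0))
      linarith [b2 t])
  rw [intervalIntegral.integral_const_mul] at hfinal
  refine hfinal.trans_lt ?_
  calc _ < (ε + 2 * R) * R := mul_lt_mul_of_pos_left hℓ (by positivity)
    _ = ε * R + 2 * R ^ 2 := by ring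

/-- **Uniform doubling in `ℍ¹`**: `|B_ε(x,2r)| ≤ C |B_ε(x,r)|` with `C` independent
of `ε > 0`, `x` and `r > 0`. -/
theorem heisenberg_uniform_doubling :
    ∃ C : ℝ, 0 < C ∧ ∀ ε : ℝ, 0 < ε → ∀ (x : Fin 3 → ℝ) (r : ℝ), 0 < r →
      volume (hBallEps ε x (2 * r)) ≤ ENNReal.ofReal C * volume (hBallEps ε x r) := by
  refine ⟨10 ^ 9, by norm_num, fun ε hε x r hr => ?_⟩
  refine (measure_mono (hBallEps_subset_heisBox hε x)).trans ?_
  rw [volume_heisBox x (by positivity)]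
  rcases le_total r ε with h | h
  · refine le_trans ?_ (mul_le_mul_right
      (measure_mono (heisBox_subset_hBallEps_riemannian hε hr x)) _)
    rw [volume_heisBox x (by positivity), ← ENNReal.ofReal_mul (by norm_num)]
    refine ENNReal.ofReal_le_ofReal ?_
    have h3 : 0 < r ^ 3 := by positivity
    nlinarith [mul_le_mul_of_nonneg_left h h3.le, mul_pos h3 hε]
  · refine le_trans ?_ (mul_le_mul_right
      (measure_mono (heisBox_subset_hBallEps_horizontal ε hr x)) _)
    rw [volume_heisBox x (by positivity), ← ENNReal.ofReal_mul (by norm_num)]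
    refine ENNReal.ofReal_le_ofReal ?_
    have h3 : 0 < r ^ 3 := by positivity
    nlinarith [mul_le_mul_of_nonneg_left h h3.le, mul_pos h3 hr]

end
end
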